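/- Let V ∈ M_d(ℂ) satisfy V*V = 1 (V is an isometry), let a₀,…,a_I be real numbers, let S₊ = {i : aᵢ ≥ 0} and S₋ = {i : aᵢ < 0}, and define Φ(X) = V*(∑_{i=0}^I aᵢ X^i)V. Let B, C_L, C_U be Hermitian matrices in M_d(ℂ) with C_L positive semidefinite, C_L ≤ B ≤ C_U in the Loewner order, 0 < λ_min(C_L) < λ_max(C_L), and 0 < λ_min(C_U) < λ_max(C_U). Then, with the convention 𝒦(m,M,0) = 𝒦(m,M,1) = 1: Φ(B) ≤ V*( ∑_{i∈S₊} aᵢ 𝒦(λ_min(C_U), λ_max(C_U), i) C_U^i + ∑_{i∈S₋} aᵢ 𝒦(λ_min(C_L), λ_max(C_L), i)⁻¹ C_L^i )V, and Φ(B) ≥ V*( ∑_{i∈S₊} aᵢ 𝒦(λ_min(C_L), λ_max(C_L), i)⁻¹ C_L^i + ∑_{i∈S₋} aᵢ 𝒦(λ_min(C_U), λ_max(C_U), i) C_U^i )V. -/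

import Mathlib

open scoped ComplexOrder Matrix

/-- The Kantorovich function `𝒦(m, M, r)` for `0 < m < M` and real `r ≠ 1`. -/
noncomputable def kantorovich (m M r : ℝ) : ℝ :=
  (m * M ^ r - M * m ^ r) / ((r - 1) * (M - m)) *
    ((r - 1) * (M ^ r - m ^ r) / (r * (m * M ^ r - M * m ^ r))) ^ r

/-- The Kantorovich function at natural exponents, with the convention
`𝒦(m,M,0) = 𝒦(m,M,1) = 1`. -/
noncomputable def kantorovichNat (m M : ℝ) (i : ℕ) : ℝ :=
  if i = 0 ∨ i = 1 then 1 else kantorovich m M (i : ℝ)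

/-- The smallest eigenvalue of a Hermitian matrix, as the infimum of its real spectrum. -/
noncomputable def lamMin {d : ℕ} (A : Matrix (Fin d) (Fin d) ℂ) : ℝ := sInf (spectrum ℝ A)

/-- The largest eigenvalue of a Hermitian matrix, as the supremum of its real spectrum. -/
noncomputable def lamMax {d : ℕ} (A : Matrix (Fin d) (Fin d) ℂ) : ℝ := sSup (spectrum ℝ A)

theorem kant_eq (m M : ℝ) (hm : 0 < m) (hM : m < M) (n : ℕ) (hn : 2 ≤ n) :
    ∃ b u : ℝ, 0 < b ∧ 0 < u ∧ kantorovich m M n = b / (n - 1) * u ^ n ∧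
      b = (m * M ^ n - M * m ^ n) / (M - m) ∧
      n * b / (n - 1) * u = (M ^ n - m ^ n) / (M - m) := by
  obtain ⟨k, rfl⟩ : ∃ k, n = k + 1 := ⟨n - 1, by omega⟩
  have hk : k ≠ 0 := by omega
  have hM0 : 0 < M := hm.trans hM
  have hd : 0 < M - m := sub_pos.2 hM
  have hkr : (0 : ℝ) < k := by exact_mod_cast Nat.pos_of_ne_zero hk
  have hc : 0 < m * M ^ (k + 1) - M * m ^ (k + 1) := by
    have h1 : m ^ k < M ^ k := pow_lt_pow_left₀ hM hm.le hk
    have : m * M ^ (k + 1) - M * m ^ (k + 1) = m * M * (M ^ k - m ^ k) := by ring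
    rw [this]
    exact mul_pos (mul_pos hm hM0) (sub_pos.2 h1)
  have hp : 0 < M ^ (k + 1) - m ^ (k + 1) :=
    sub_pos.2 (pow_lt_pow_left₀ hM hm.le (by omega))
  refine ⟨(m * M ^ (k + 1) - M * m ^ (k + 1)) / (M - m),
    k * (M ^ (k + 1) - m ^ (k + 1)) / ((k + 1) * (m * M ^ (k + 1) - M * m ^ (k + 1))),
    by positivity, by positivity, ?_, rfl, ?_⟩
  · unfold kantorovich
    simp only [Real.rpow_natCast]
    push_cast
    rw [add_sub_cancel_right, div_div, mul_comm (M - m)]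
  · generalize m * M ^ (k + 1) - M * m ^ (k + 1) = c at *
    generalize M ^ (k + 1) - m ^ (k + 1) = p at *
    push_cast
    rw [add_sub_cancel_right]
    field_simp

theorem kant_pos (m M : ℝ) (hm : 0 < m) (hM : m < M) (n : ℕ) :
    0 < kantorovichNat m M n := by
  unfold kantorovichNat
  split_ifs with h
  · exact one_pos
  · push Not at h
    have hn : 2 ≤ n := by omega
    obtain ⟨b, u, hb, hu, h1, -, -⟩ := kant_eq m M hm hM n hn
    rw [h1]
    have : (2 : ℝ) ≤ n := by exact_mod_cast hn
    have : (0 : ℝ) < n - 1 := by linarith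
    positivity

theorem kant_inv (m M : ℝ) (hm : 0 < m) (hM : m < M) (n : ℕ) :
    kantorovichNat M⁻¹ m⁻¹ n = kantorovichNat m M n := by
  unfold kantorovichNat
  split_ifs with h
  · rfl
  · push Not at h
    obtain ⟨k, rfl⟩ : ∃ k, n = k + 1 := ⟨n - 1, by omega⟩
    have hM0 : 0 < M := hm.trans hM
    have hd : 0 < M - m := sub_pos.2 hM
    have hkr : (0 : ℝ) < k := by exact_mod_cast (by omega : 0 < k)
    have hc : 0 < m * M ^ (k + 1) - M * m ^ (k + 1) := by
      have h1 : m ^ k < M ^ k := pow_lt_pow_left₀ hM hm.le (by omega)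
      have : m * M ^ (k + 1) - M * m ^ (k + 1) = m * M * (M ^ k - m ^ k) := by ring
      rw [this]
      exact mul_pos (mul_pos hm hM0) (sub_pos.2 h1)
    unfold kantorovich
    simp only [Real.rpow_natCast]
    have e1 : M⁻¹ * m⁻¹ ^ (k + 1) - m⁻¹ * M⁻¹ ^ (k + 1)
        = (m * M ^ (k + 1) - M * m ^ (k + 1)) / (m * M) ^ (k + 2) := by
      rw [inv_pow, inv_pow, mul_pow]
      field_simp
      try ring
    have e2 : m⁻¹ ^ (k + 1) - M⁻¹ ^ (k + 1) = (M ^ (k + 1) - m ^ (k + 1)) / (m * M) ^ (k + 1) := by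
      rw [inv_pow, inv_pow, mul_pow]
      field_simp
    have e3 : m⁻¹ - M⁻¹ = (M - m) / (m * M) := by field_simp
    rw [e1, e2, e3]
    generalize m * M ^ (k + 1) - M * m ^ (k + 1) = c at *
    generalize M ^ (k + 1) - m ^ (k + 1) = p at *
    push_cast
    rw [add_sub_cancel_right]
    have e4 : (k : ℝ) * (p / (m * M) ^ (k + 1)) / ((k + 1) * (c / (m * M) ^ (k + 2)))
        = (m * M) * (k * p / ((k + 1) * c)) := by
      field_simp
      try ring
    rw [e4, mul_pow]
    field_simp
    try ring

theorem scalar_lines (m M : ℝ) (hm : 0 < m) (hM : m < M) (n : ℕ) (hn : 2 ≤ n) :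
    ∃ α β : ℝ, 0 ≤ α ∧ (∀ t ∈ Set.Icc m M, t ^ n ≤ α * t + β) ∧
      ∀ t : ℝ, 0 ≤ t → α * t + β ≤ kantorovich m M n * t ^ n := by
  obtain ⟨b, u, hb, hu, h1, h2, h3⟩ := kant_eq m M hm hM n hn
  have hn' : (2 : ℝ) ≤ n := by exact_mod_cast hn
  have hn1 : (0 : ℝ) < n - 1 := by linarith
  have hd : 0 < M - m := sub_pos.2 hM
  refine ⟨n * b / (n - 1) * u, -b, by positivity, ?_, ?_⟩
  · rintro t ⟨ht1, ht2⟩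
    have hc := (convexOn_pow (𝕜 := ℝ) n).2 (Set.mem_Ici.2 hm.le) (Set.mem_Ici.2 (hm.trans hM).le)
      (div_nonneg (by linarith) hd.le : 0 ≤ (M - t) / (M - m))
      (div_nonneg (by linarith) hd.le : 0 ≤ (t - m) / (M - m))
      (by field_simp; ring)
    simp only [smul_eq_mul] at hc
    have e : (M - t) / (M - m) * m + (t - m) / (M - m) * M = t := by field_simp; ring
    rw [e] at hc
    refine hc.trans (le_of_eq ?_)
    rw [h3, h2]
    field_simp
    ring
  · intro t ht
    have hB := one_add_mul_le_pow (a := u * t - 1) (by nlinarith [mul_nonneg hu.le ht]) n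
    rw [add_sub_cancel] at hB
    rw [h1]
    have e : b / (n - 1) * u ^ n * t ^ n = b / (n - 1) * (u * t) ^ n := by ring
    rw [e]
    refine le_trans (le_of_eq ?_)
      (mul_le_mul_of_nonneg_left hB (by positivity : (0 : ℝ) ≤ b / (n - 1)))
    field_simp
    ring

section abstract
variable {A : Type*} [CStarAlgebra A] [PartialOrder A] [StarOrderedRing A]

theorem cfc_line (x : A) (hx : IsSelfAdjoint x) (α β : ℝ) :
    cfc (fun t : ℝ => α * t + β) x = α • x + algebraMap ℝ A β := by
  rw [cfc_add_const β (fun t : ℝ => α * t) x, cfc_const_mul_id α x]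

theorem cfc_kpow (x : A) (hx : IsSelfAdjoint x) (K : ℝ) (n : ℕ) :
    cfc (fun t : ℝ => K * t ^ n) x = K • x ^ n := by
  rw [cfc_const_mul K (fun t : ℝ => t ^ n) x, cfc_pow_id x n]

theorem lower_case (m M : ℝ) (hm : 0 < m) (hM : m < M) (n : ℕ) (x y : A)
    (hx1 : algebraMap ℝ A m ≤ x) (hx2 : x ≤ algebraMap ℝ A M) (hxy : x ≤ y) :
    x ^ n ≤ kantorovichNat m M n • y ^ n := by
  unfold kantorovichNat
  split_ifs with h
  · rcases h with rfl | rfl <;> simp [hxy]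
  · push Not at h
    have hn : 2 ≤ n := by omega
    have hx0 : 0 ≤ x := le_trans (algebraMap_nonneg A hm.le) hx1
    have hy0 : 0 ≤ y := hx0.trans hxy
    have hxs : IsSelfAdjoint x := .of_nonneg hx0
    have hys : IsSelfAdjoint y := .of_nonneg hy0
    obtain ⟨α, β, hα, h1, h2⟩ := scalar_lines m M hm hM n hn
    rw [algebraMap_le_iff_le_spectrum (a := x)] at hx1
    rw [le_algebraMap_iff_spectrum_le (a := x)] at hx2
    calc x ^ n = cfc (fun t : ℝ => t ^ n) x := (cfc_pow_id x n).symm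
      _ ≤ cfc (fun t : ℝ => α * t + β) x :=
        cfc_mono (fun t ht => h1 t ⟨hx1 t ht, hx2 t ht⟩)
      _ = α • x + algebraMap ℝ A β := cfc_line x hxs α β
      _ ≤ α • y + algebraMap ℝ A β := by gcongr
      _ = cfc (fun t : ℝ => α * t + β) y := (cfc_line y hys α β).symm
      _ ≤ cfc (fun t : ℝ => kantorovich m M n * t ^ n) y :=
        cfc_mono (fun t ht => h2 t (spectrum_nonneg_of_nonneg hy0 ht))
      _ = _ := cfc_kpow y hys _ n

theorem upper_case (m M : ℝ) (hm : 0 < m) (hM : m < M) (n : ℕ) (x y : Aˣ) (hx : 0 ≤ (x : A))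
    (hy1 : algebraMap ℝ A m ≤ y) (hy2 : y ≤ algebraMap ℝ A M) (hxy : (x : A) ≤ y) :
    (x : A) ^ n ≤ kantorovichNat m M n • (y : A) ^ n := by
  have hM0 : 0 < M := hm.trans hM
  have hy := hx.trans hxy
  have key : ∀ r : ℝ, 0 < r → ∃ z : Aˣ, (z : A) = algebraMap ℝ A r ∧
      ((z⁻¹ : Aˣ) : A) = algebraMap ℝ A r⁻¹ := fun r hr =>
    ⟨⟨algebraMap ℝ A r, algebraMap ℝ A r⁻¹, by rw [← map_mul, mul_inv_cancel₀ hr.ne', map_one],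
      by rw [← map_mul, inv_mul_cancel₀ hr.ne', map_one]⟩, rfl, rfl⟩
  obtain ⟨zm, zm1, zm2⟩ := key m hm
  obtain ⟨zM, zM1, zM2⟩ := key M hM0
  have K0 := kant_pos m M hm hM n
  obtain ⟨zK, zK1, zK2⟩ := key _ K0
  have i1 : ((y⁻¹ : Aˣ) : A) ≤ algebraMap ℝ A m⁻¹ := by
    rw [← zm2]
    exact CStarAlgebra.inv_le_inv (by rw [zm1]; exact algebraMap_nonneg A hm.le) (by rwa [zm1])
  have i2 : algebraMap ℝ A M⁻¹ ≤ ((y⁻¹ : Aˣ) : A) := by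
    rw [← zM2]
    exact CStarAlgebra.inv_le_inv hy (by rwa [zM1])
  have i3 := CStarAlgebra.inv_le_inv hx hxy
  have h := lower_case M⁻¹ m⁻¹ (inv_pos.2 hM0) ((inv_lt_inv₀ hM0 hm).2 hM) n _ _ i2 i1 i3
  rw [kant_inv m M hm hM, Algebra.smul_def, ← zK1] at h
  have h' : (((y ^ n)⁻¹ : Aˣ) : A) ≤ ((zK * (x ^ n)⁻¹ : Aˣ) : A) := by
    simpa [← inv_pow] using h
  have h0 : (0 : A) ≤ (((y ^ n)⁻¹ : Aˣ) : A) :=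
    CFC.inv_nonneg_of_nonneg _ (by
      rw [Units.val_pow_eq_pow_val]
      have hys : IsSelfAdjoint (y : A) := .of_nonneg hy
      rw [← cfc_pow_id (R := ℝ) (y : A) n]
      exact cfc_nonneg fun t ht => pow_nonneg (spectrum_nonneg_of_nonneg hy ht) n)
  have h'' := CStarAlgebra.inv_le_inv h0 h'
  rw [mul_inv_rev, inv_inv, inv_inv, Units.val_mul, zK2, Units.val_pow_eq_pow_val,
    Units.val_pow_eq_pow_val, ← Algebra.commutes, ← Algebra.smul_def] at h''
  have := smul_le_smul_of_nonneg_left h'' K0.le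
  rwa [smul_smul, mul_inv_cancel₀ K0.ne', one_smul] at this

end abstract

section mat
open scoped MatrixOrder Matrix.Norms.L2Operator

theorem spec_bounds {d : ℕ} (C : Matrix (Fin d) (Fin d) ℂ) (hC : C.IsHermitian) :
    algebraMap ℝ _ (lamMin C) ≤ C ∧ C ≤ algebraMap ℝ _ (lamMax C) := by
  have hs : IsSelfAdjoint C := hC
  have hk : IsCompact (spectrum ℝ C) := ContinuousFunctionalCalculus.isCompact_spectrum C
  exact ⟨algebraMap_le_of_le_spectrum (fun t ht => csInf_le hk.bddBelow ht),
    le_algebraMap_of_spectrum_le (fun t ht => le_csSup hk.bddAbove ht)⟩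

theorem conj_sum {d : ℕ} (V : Matrix (Fin d) (Fin d) ℂ) (I : ℕ) (a : ℕ → ℝ)
    (B P Q : ℕ → Matrix (Fin d) (Fin d) ℂ) (hP : ∀ i, 0 ≤ a i → a i • B i ≤ a i • P i)
    (hQ : ∀ i, a i < 0 → a i • B i ≤ a i • Q i) :
    Vᴴ * (∑ i ∈ Finset.range (I + 1), a i • B i) * V ≤
    Vᴴ * ((∑ i ∈ (Finset.range (I + 1)).filter (fun i => 0 ≤ a i), a i • P i) +
          ∑ i ∈ (Finset.range (I + 1)).filter (fun i => a i < 0), a i • Q i) * V := by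
  refine star_left_conjugate_le_conjugate ?_ V
  rw [← Finset.sum_filter_add_sum_filter_not (Finset.range (I + 1)) (fun i => 0 ≤ a i)]
  simp only [not_le]
  exact add_le_add (Finset.sum_le_sum fun i hi => hP i (Finset.mem_filter.1 hi).2)
    (Finset.sum_le_sum fun i hi => hQ i (Finset.mem_filter.1 hi).2)

theorem mat_bounds {d : ℕ} (B CL CU : Matrix (Fin d) (Fin d) ℂ)
    (hCL : CL.IsHermitian) (hCU : CU.IsHermitian)
    (hLB : CL ≤ B) (hBU : B ≤ CU)
    (hL0 : 0 < lamMin CL) (hL1 : lamMin CL < lamMax CL)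
    (hU0 : 0 < lamMin CU) (hU1 : lamMin CU < lamMax CU) (i : ℕ) :
    (kantorovichNat (lamMin CL) (lamMax CL) i)⁻¹ • CL ^ i ≤ B ^ i ∧
    B ^ i ≤ kantorovichNat (lamMin CU) (lamMax CU) i • CU ^ i := by
  obtain ⟨l1, l2⟩ := spec_bounds CL hCL
  obtain ⟨u1, u2⟩ := spec_bounds CU hCU
  constructor
  · have K0 := kant_pos _ _ hL0 hL1 i
    have := smul_le_smul_of_nonneg_left (lower_case _ _ hL0 hL1 i CL B l1 l2 hLB)
      (inv_nonneg.2 K0.le)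
    rwa [smul_smul, inv_mul_cancel₀ K0.ne', one_smul] at this
  · have hun : ∀ (r : ℝ) (X : Matrix (Fin d) (Fin d) ℂ), 0 < r → algebraMap ℝ _ r ≤ X →
        0 ≤ X ∧ IsUnit X := by
      intro r X hr h
      have h0 : 0 ≤ X := (algebraMap_nonneg _ hr.le).trans h
      refine ⟨h0, ?_⟩
      have hs : IsSelfAdjoint X := .of_nonneg h0
      rw [algebraMap_le_iff_le_spectrum (a := X)] at h
      rw [← spectrum.zero_notMem_iff ℝ]
      intro h2
      linarith [h 0 h2]
    obtain ⟨hB0, hB1⟩ := hun _ B hL0 (l1.trans hLB)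
    obtain ⟨hC0, hC1⟩ := hun _ CU hU0 u1
    obtain ⟨x, rfl⟩ := hB1
    obtain ⟨y, rfl⟩ := hC1
    exact upper_case _ _ hU0 hU1 i x y hB0 u1 u2 hBU

end mat

/-- Bounds on `Φ(B) = V*(∑ᵢ aᵢ Bⁱ)V` for an isometry `V` in terms of the Kantorovich
constants and the Loewner bounds `C_L ≤ B ≤ C_U`, splitting the sum according to the signs
of the coefficients `aᵢ`. -/
theorem polynomial_map_kantorovich_bounds
    (d : ℕ) (V : Matrix (Fin d) (Fin d) ℂ) (hV : Vᴴ * V = 1)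
    (I : ℕ) (a : ℕ → ℝ)
    (B CL CU : Matrix (Fin d) (Fin d) ℂ)
    (hB : B.IsHermitian) (hCL : CL.IsHermitian) (hCU : CU.IsHermitian)
    (hCLpsd : CL.PosSemidef)
    (hLB : (B - CL).PosSemidef) (hBU : (CU - B).PosSemidef)
    (hL0 : 0 < lamMin CL) (hL1 : lamMin CL < lamMax CL)
    (hU0 : 0 < lamMin CU) (hU1 : lamMin CU < lamMax CU) :
    (Vᴴ * ((∑ i ∈ (Finset.range (I + 1)).filter (fun i => 0 ≤ a i),
            a i • (kantorovichNat (lamMin CU) (lamMax CU) i • CU ^ i)) +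
          ∑ i ∈ (Finset.range (I + 1)).filter (fun i => a i < 0),
            a i • ((kantorovichNat (lamMin CL) (lamMax CL) i)⁻¹ • CL ^ i)) * V -
        Vᴴ * (∑ i ∈ Finset.range (I + 1), a i • B ^ i) * V).PosSemidef ∧
    (Vᴴ * (∑ i ∈ Finset.range (I + 1), a i • B ^ i) * V -
        Vᴴ * ((∑ i ∈ (Finset.range (I + 1)).filter (fun i => 0 ≤ a i),
            a i • ((kantorovichNat (lamMin CL) (lamMax CL) i)⁻¹ • CL ^ i)) +
          ∑ i ∈ (Finset.range (I + 1)).filter (fun i => a i < 0),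
            a i • (kantorovichNat (lamMin CU) (lamMax CU) i • CU ^ i)) * V).PosSemidef := by
  have hb := mat_bounds B CL CU hCL hCU (Matrix.le_iff.2 hLB) (Matrix.le_iff.2 hBU) hL0 hL1 hU0 hU1
  open scoped MatrixOrder Matrix.Norms.L2Operator in
  constructor
  · rw [← Matrix.le_iff]
    exact conj_sum V I a (fun i => B ^ i) _ _
      (fun i hi => smul_le_smul_of_nonneg_left (hb i).2 hi)
      (fun i hi => smul_le_smul_of_nonpos_left (hb i).1 hi.le)
  · rw [← Matrix.le_iff]
    have h := conj_sum V I (fun i => a i) (fun i => -B ^ i)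
      (fun i => -((kantorovichNat (lamMin CL) (lamMax CL) i)⁻¹ • CL ^ i))
      (fun i => -(kantorovichNat (lamMin CU) (lamMax CU) i • CU ^ i))
      (fun i hi => smul_le_smul_of_nonneg_left (neg_le_neg (hb i).1) hi)
      (fun i hi => smul_le_smul_of_nonpos_left (neg_le_neg (hb i).2) hi.le)
    simp only [smul_neg, Finset.sum_neg_distrib, ← neg_add, mul_neg, neg_mul] at h
    exact neg_le_neg_iff.1 h
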